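/- arXiv:2111.14699 — 2 statements merged into one kernel-verified Lean document; each statement's English description precedes it below -/
import Mathlib

section
/- There exist a real polynomial u and a real constant c > 0 such that the even Schwartz function f(x) = u(x²) e^{−x²/2} satisfies: (i) f(x) ≤ 0 for all x ∈ ℝ; (ii) f̂(√(λ − 1/4)) ≥ c for all λ ∈ [2.2, 3.5]; (iii) f̂(√(λ − 1/4)) ≥ 0 for all λ ≥ 3.5; (iv) (1/c) · ( 2 ∫₀^∞ ξ f̂(ξ) tanh(πξ) dξ − (1/√(2π)) ∫_ℝ f(x) cosh(x/2) dx ) < 7. -/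
open Real MeasureTheory

/-- The even function `x ↦ u(x²) e^{-x²/2}` associated to a real polynomial `u`. -/
noncomputable def gaussPoly (u : Polynomial ℝ) (x : ℝ) : ℝ :=
  u.eval (x ^ 2) * Real.exp (-x ^ 2 / 2)

/-- The Fourier transform `f̂(ξ) = (1/√(2π)) ∫_ℝ f(x) e^{-iξx} dx` of an even real-valued
function, written in its real form `(1/√(2π)) ∫_ℝ f(x) cos(ξ x) dx`. -/
noncomputable def evenFT (f : ℝ → ℝ) (ξ : ℝ) : ℝ :=
  (1 / Real.sqrt (2 * π)) * ∫ x : ℝ, f x * Real.cos (ξ * x)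

/-- The exponentially tilted Gaussian `x ↦ e^{-x²/2 + zx}`. -/
noncomputable def tiltedGauss (z : ℂ) (x : ℝ) : ℂ :=
  Complex.exp (-(x : ℂ) ^ 2 / 2 + z * x)

lemma tiltedGauss_eq_quadratic (z : ℂ) :
    tiltedGauss z = fun x : ℝ ↦ Complex.exp ((-1 / 2 : ℂ) * (x : ℂ) ^ 2 + z * x + 0) := by
  funext x
  unfold tiltedGauss
  congr 1
  ring

lemma integrable_tiltedGauss (z : ℂ) : Integrable (tiltedGauss z) := by
  rw [tiltedGauss_eq_quadratic]
  exact integrable_cexp_quadratic' (by norm_num) z 0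

lemma integral_tiltedGauss (z : ℂ) :
    ∫ x, tiltedGauss z x = (√(2 * π) : ℂ) * Complex.exp (z ^ 2 / 2) := by
  rw [tiltedGauss_eq_quadratic, integral_cexp_quadratic (by norm_num)]
  congr 1
  · rw [Real.sqrt_eq_rpow, Complex.ofReal_cpow (by positivity)]
    push_cast
    congr 1
    ring
  · congr 1
    ring

lemma continuous_tiltedGauss (z : ℂ) : Continuous (tiltedGauss z) := by
  unfold tiltedGauss
  fun_prop

lemma norm_tiltedGauss (z : ℂ) (x : ℝ) :
    ‖tiltedGauss z x‖ = Real.exp (-x ^ 2 / 2 + z.re * x) := by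
  rw [tiltedGauss, Complex.norm_exp]
  congr 1
  have h : (-(x : ℂ) ^ 2 / 2) = ((-x ^ 2 / 2 : ℝ) : ℂ) := by push_cast; rfl
  rw [h, Complex.add_re, Complex.ofReal_re, Complex.re_mul_ofReal]

lemma integrable_pow_mul_tiltedGauss (m : ℕ) (z : ℂ) :
    Integrable fun x : ℝ ↦ (x : ℂ) ^ m * tiltedGauss z x := by
  refine Integrable.mono' (g := fun x ↦ (m.factorial : ℝ) *
      (‖tiltedGauss (z + 1) x‖ + ‖tiltedGauss (z - 1) x‖))
    (((integrable_tiltedGauss _).norm.add (integrable_tiltedGauss _).norm).const_mul _) ?_ ?_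
  · have := continuous_tiltedGauss z
    exact (by fun_prop : Continuous _).aestronglyMeasurable
  · refine Filter.Eventually.of_forall fun x ↦ ?_
    simp only [norm_mul, norm_pow, Complex.norm_real, norm_tiltedGauss, Complex.add_re,
      Complex.sub_re, Complex.one_re, Real.norm_eq_abs]
    have h1 : |x| ^ m ≤ m.factorial * Real.exp |x| := by
      have := Real.pow_div_factorial_le_exp |x| (abs_nonneg x) m
      rwa [div_le_iff₀ (by positivity), mul_comm] at this
    have h2 : Real.exp |x| ≤ Real.exp x + Real.exp (-x) := by
      rcases abs_cases x with ⟨h, -⟩ | ⟨h, -⟩ <;> rw [h] <;>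
        linarith [Real.exp_pos x, Real.exp_pos (-x)]
    calc |x| ^ m * Real.exp (-x ^ 2 / 2 + z.re * x)
        ≤ (m.factorial * (Real.exp x + Real.exp (-x))) * Real.exp (-x ^ 2 / 2 + z.re * x) := by
          gcongr
          exact h1.trans (by gcongr)
      _ = _ := by
          rw [mul_assoc, add_mul, ← Real.exp_add, ← Real.exp_add]
          ring_nf

lemma hasDerivAt_tiltedGauss (z : ℂ) (x : ℝ) :
    HasDerivAt (tiltedGauss z) ((z - x) * tiltedGauss z x) x := by
  have h : HasDerivAt (fun w : ℂ ↦ Complex.exp (-w ^ 2 / 2 + z * w))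
      (Complex.exp (-(x : ℂ) ^ 2 / 2 + z * x) * (-((2 : ℕ) * (x : ℂ) ^ 1) / 2 + z * 1)) x := by
    refine ((((hasDerivAt_pow 2 (x : ℂ)).neg).div_const 2).add
      ((hasDerivAt_id (x : ℂ)).const_mul z)).cexp
  refine h.comp_ofReal.congr_deriv ?_
  rw [tiltedGauss]
  push_cast
  ring

/-- The moments of the tilted Gaussian. -/
noncomputable def tiltedMoment (z : ℂ) (m : ℕ) : ℂ :=
  ∫ x : ℝ, (x : ℂ) ^ m * tiltedGauss z x

lemma tiltedMoment_succ (z : ℂ) (m : ℕ) :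
    tiltedMoment z (m + 1) = z * tiltedMoment z m + m * tiltedMoment z (m - 1) := by
  have hd (x : ℝ) : HasDerivAt (fun x : ℝ ↦ (x : ℂ) ^ m * tiltedGauss z x)
      (m * ((x : ℂ) ^ (m - 1) * tiltedGauss z x) + z * ((x : ℂ) ^ m * tiltedGauss z x)
        - (x : ℂ) ^ (m + 1) * tiltedGauss z x) x := by
    convert! ((hasDerivAt_pow m (x : ℂ)).comp_ofReal).mul (hasDerivAt_tiltedGauss z x) using 1
    ring
  have h1 := (integrable_pow_mul_tiltedGauss (m - 1) z).const_mul (m : ℂ)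
  have h2 := (integrable_pow_mul_tiltedGauss m z).const_mul z
  have h3 := integrable_pow_mul_tiltedGauss (m + 1) z
  have h12 : Integrable fun x : ℝ ↦ m * ((x : ℂ) ^ (m - 1) * tiltedGauss z x)
      + z * ((x : ℂ) ^ m * tiltedGauss z x) := h1.add h2
  have h := integral_eq_zero_of_hasDerivAt_of_integrable hd (h12.sub h3)
    (integrable_pow_mul_tiltedGauss m z)
  rw [integral_sub h12 h3, integral_add h1 h2, integral_const_mul,
    integral_const_mul] at h
  unfold tiltedMoment
  linear_combination -h

lemma tiltedMoment_zero (z : ℂ) :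
    tiltedMoment z 0 = (√(2 * π) : ℂ) * Complex.exp (z ^ 2 / 2) := by
  simp [tiltedMoment, integral_tiltedGauss]

lemma ofReal_gaussPoly_mul_cexp (u : Polynomial ℝ) (z : ℂ) (x : ℝ) :
    (gaussPoly u x : ℂ) * Complex.exp (z * x) =
      ∑ j ∈ Finset.range (u.natDegree + 1),
        (u.coeff j : ℂ) * ((x : ℂ) ^ (2 * j) * tiltedGauss z x) := by
  rw [gaussPoly, Polynomial.eval_eq_sum_range, tiltedGauss, Complex.exp_add]
  push_cast
  rw [Finset.sum_mul, Finset.sum_mul]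
  refine Finset.sum_congr rfl fun j _ ↦ ?_
  rw [pow_mul]
  ring

lemma integrable_gaussPoly_mul_cexp (u : Polynomial ℝ) (z : ℂ) :
    Integrable fun x : ℝ ↦ (gaussPoly u x : ℂ) * Complex.exp (z * x) := by
  simp_rw [ofReal_gaussPoly_mul_cexp]
  exact integrable_finsetSum _ fun j _ ↦ (integrable_pow_mul_tiltedGauss (2 * j) z).const_mul _

lemma integral_gaussPoly_mul_cexp (u : Polynomial ℝ) (z : ℂ) :
    ∫ x : ℝ, (gaussPoly u x : ℂ) * Complex.exp (z * x) =
      ∑ j ∈ Finset.range (u.natDegree + 1), (u.coeff j : ℂ) * tiltedMoment z (2 * j) := by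
  simp_rw [ofReal_gaussPoly_mul_cexp]
  rw [integral_finsetSum _ fun j _ ↦ (integrable_pow_mul_tiltedGauss (2 * j) z).const_mul _]
  simp_rw [integral_const_mul, tiltedMoment]

/-- If the bilateral Laplace transform of `gaussPoly u` is `√(2π) p(-z²) e^{z²/2}`, then its Fourier
transform is `gaussPoly p`. -/
lemma evenFT_gaussPoly {u p : Polynomial ℝ}
    (h : ∀ z : ℂ, ∫ x : ℝ, (gaussPoly u x : ℂ) * Complex.exp (z * x) =
      (√(2 * π) : ℂ) * (p.aeval (-z ^ 2) * Complex.exp (z ^ 2 / 2))) (ξ : ℝ) :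
    evenFT (gaussPoly u) ξ = gaussPoly p ξ := by
  have hre (x : ℝ) : ((gaussPoly u x : ℂ) * Complex.exp (ξ * Complex.I * x)).re =
      gaussPoly u x * Real.cos (ξ * x) := by
    rw [Complex.re_ofReal_mul, show (ξ : ℂ) * Complex.I * x = ((ξ * x : ℝ) : ℂ) * Complex.I by
      push_cast; ring, Complex.exp_ofReal_mul_I_re]
  have hsq : ((ξ : ℂ) * Complex.I) ^ 2 = ((-ξ ^ 2 : ℝ) : ℂ) := by
    rw [mul_pow, Complex.I_sq]; push_cast; ring
  have hI := integral_re (𝕜 := ℂ) (integrable_gaussPoly_mul_cexp u (ξ * Complex.I))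
  simp only [RCLike.re_eq_complex_re, hre] at hI
  have hval : (p.aeval (-((-ξ ^ 2 : ℝ) : ℂ)) : ℂ) * Complex.exp (((-ξ ^ 2 : ℝ) : ℂ) / 2) =
      ((gaussPoly p ξ : ℝ) : ℂ) := by
    rw [gaussPoly, Complex.ofReal_mul, Complex.ofReal_exp, ← Complex.ofReal_neg, neg_neg]
    push_cast
    congr 1
    rw [← Complex.ofReal_pow, Polynomial.aeval_def, Complex.coe_algebraMap.symm,
      Polynomial.eval₂_at_apply]
  rw [evenFT, hI, h, hsq, hval, ← Complex.ofReal_mul, Complex.ofReal_re]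
  field_simp

lemma integral_gaussPoly_mul_cosh {u p : Polynomial ℝ}
    (h : ∀ z : ℂ, ∫ x : ℝ, (gaussPoly u x : ℂ) * Complex.exp (z * x) =
      (√(2 * π) : ℂ) * (p.aeval (-z ^ 2) * Complex.exp (z ^ 2 / 2))) (b : ℝ) :
    (1 / √(2 * π)) * ∫ x : ℝ, gaussPoly u x * Real.cosh (b * x) =
      p.eval (-b ^ 2) * Real.exp (b ^ 2 / 2) := by
  have hval (b : ℝ) : ∫ x : ℝ, gaussPoly u x * Real.exp (b * x) =
      √(2 * π) * (p.eval (-b ^ 2) * Real.exp (b ^ 2 / 2)) := by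
    have := h b
    rw [← Complex.ofReal_inj, ← integral_complex_ofReal]
    push_cast
    rw [this, ← Complex.ofReal_pow, ← Complex.ofReal_neg, Polynomial.aeval_def,
      Complex.coe_algebraMap.symm, Polynomial.eval₂_at_apply]
  have hint (b : ℝ) : Integrable fun x : ℝ ↦ gaussPoly u x * Real.exp (b * x) := by
    have := (integrable_gaussPoly_mul_cexp u b).re
    convert! this using 2 with x
    simp [← Complex.ofReal_mul, ← Complex.ofReal_exp]
  have hc (x : ℝ) : gaussPoly u x * Real.cosh (b * x) =
      2⁻¹ * (gaussPoly u x * Real.exp (b * x) + gaussPoly u x * Real.exp (-b * x)) := by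
    rw [Real.cosh_eq, neg_mul]; ring
  simp_rw [hc]
  rw [integral_const_mul, integral_add (hint b) (hint (-b)), hval, hval, neg_sq]
  field_simp
  ring

lemma integral_Ioi_pow_mul_exp_neg_sq_div_two (k : ℕ) :
    ∫ ξ in Set.Ioi (0 : ℝ), ξ * ((ξ ^ 2) ^ k * Real.exp (-ξ ^ 2 / 2)) = 2 ^ k * k.factorial := by
  have h := integral_rpow_mul_exp_neg_mul_rpow (p := 2) (q := 2 * k + 1) (b := 1 / 2)
    (by norm_num) (by have := k.cast_nonneg (α := ℝ); linarith) (by norm_num)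
  rw [show ((2 * k + 1 + 1 : ℝ) / 2) = k + 1 by ring, Real.Gamma_nat_eq_factorial,
    show (-((2 * k + 1 + 1 : ℝ)) / 2) = -((k + 1 : ℕ) : ℝ) by push_cast; ring,
    Real.rpow_neg (by norm_num), Real.rpow_natCast] at h
  have h' : (2 : ℝ) ^ k * k.factorial = ((1 / 2) ^ (k + 1))⁻¹ * (1 / 2) * k.factorial := by
    rw [pow_succ, mul_inv, one_div, inv_pow, inv_inv]; ring
  rw [h', ← h]
  refine setIntegral_congr_fun measurableSet_Ioi fun x (hx : 0 < x) ↦ ?_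
  have : x ^ (2 * k + 1 : ℝ) = x * (x ^ 2) ^ k := by
    rw [← pow_mul, show (2 * k + 1 : ℝ) = ((2 * k + 1 : ℕ) : ℝ) by push_cast; rfl,
      Real.rpow_natCast]
    ring
  simp only [this, Real.rpow_ofNat]
  ring_nf

lemma integrableOn_Ioi_pow_mul_exp_neg_sq_div_two (k : ℕ) :
    IntegrableOn (fun ξ : ℝ ↦ ξ * ((ξ ^ 2) ^ k * Real.exp (-ξ ^ 2 / 2))) (Set.Ioi 0) := by
  by_contra h
  have := integral_undef h
  rw [integral_Ioi_pow_mul_exp_neg_sq_div_two] at this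
  exact (by positivity : (2 : ℝ) ^ k * k.factorial ≠ 0) this

lemma id_mul_gaussPoly (p : Polynomial ℝ) (ξ : ℝ) :
    ξ * gaussPoly p ξ = ∑ k ∈ Finset.range (p.natDegree + 1),
      p.coeff k * (ξ * ((ξ ^ 2) ^ k * Real.exp (-ξ ^ 2 / 2))) := by
  rw [gaussPoly, Polynomial.eval_eq_sum_range, Finset.sum_mul, Finset.mul_sum]
  exact Finset.sum_congr rfl fun k _ ↦ by ring

lemma integrableOn_Ioi_id_mul_gaussPoly (p : Polynomial ℝ) :
    IntegrableOn (fun ξ : ℝ ↦ ξ * gaussPoly p ξ) (Set.Ioi 0) := by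
  simp_rw [id_mul_gaussPoly]
  exact integrable_finsetSum _ fun k _ ↦
    (integrableOn_Ioi_pow_mul_exp_neg_sq_div_two k).const_mul _

lemma integral_Ioi_id_mul_gaussPoly (p : Polynomial ℝ) :
    ∫ ξ in Set.Ioi (0 : ℝ), ξ * gaussPoly p ξ =
      ∑ k ∈ Finset.range (p.natDegree + 1), p.coeff k * (2 ^ k * k.factorial) := by
  simp_rw [id_mul_gaussPoly]
  rw [integral_finsetSum _ fun k _ ↦
    (integrableOn_Ioi_pow_mul_exp_neg_sq_div_two k).const_mul _]
  simp_rw [integral_const_mul, integral_Ioi_pow_mul_exp_neg_sq_div_two]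

lemma integral_Ioi_id_mul_exp_neg_mul {r : ℝ} (hr : 0 < r) :
    ∫ ξ in Set.Ioi (0 : ℝ), ξ * Real.exp (-(r * ξ)) = 1 / r ^ 2 := by
  have h := Real.integral_rpow_mul_exp_neg_mul_Ioi (a := 2) (by norm_num) hr
  norm_num at h
  rw [h, one_div]

lemma integrableOn_Ioi_id_mul_exp_neg_mul {r : ℝ} (hr : 0 < r) :
    IntegrableOn (fun ξ : ℝ ↦ ξ * Real.exp (-(r * ξ))) (Set.Ioi 0) := by
  by_contra h
  have := integral_undef h
  rw [integral_Ioi_id_mul_exp_neg_mul hr] at this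
  exact (by positivity : 1 / r ^ 2 ≠ 0) this

lemma one_sub_two_mul_exp_neg_le_tanh (y : ℝ) :
    1 - 2 * Real.exp (-(2 * y)) ≤ Real.tanh y := by
  have h : Real.exp (-(2 * y)) = Real.exp (-y) * Real.exp (-y) := by
    rw [← Real.exp_add]; ring_nf
  have h1 : Real.exp y * Real.exp (-y) = 1 := by rw [← Real.exp_add]; simp
  have hy := Real.exp_pos y
  have hy' := Real.exp_pos (-y)
  rw [Real.tanh_eq_sinh_div_cosh, Real.sinh_eq, Real.cosh_eq, h, le_div_iff₀ (by positivity)]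
  have h2 : Real.exp (-y) * Real.exp (-y) * Real.exp y = Real.exp (-y) := by
    rw [mul_assoc, mul_comm (Real.exp (-y)) (Real.exp y), h1, mul_one]
  have h3 : 0 < Real.exp (-y) * Real.exp (-y) * Real.exp (-y) := by positivity
  nlinarith

/-- Replacing `tanh (πξ)` by `1` costs at most `A / (2π²)` when the integrand is bounded below
by `-A`. -/
lemma integral_Ioi_id_mul_gaussPoly_mul_tanh_le {p : Polynomial ℝ} {A : ℝ} (hA : 0 ≤ A)
    (hp : ∀ ξ : ℝ, -A ≤ gaussPoly p ξ) :
    ∫ ξ in Set.Ioi (0 : ℝ), ξ * gaussPoly p ξ * Real.tanh (π * ξ) ≤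
      (∫ ξ in Set.Ioi (0 : ℝ), ξ * gaussPoly p ξ) + A / (2 * π ^ 2) := by
  have h1 := integrableOn_Ioi_id_mul_gaussPoly p
  have hr : 0 < 2 * π := by positivity
  have h2 := (integrableOn_Ioi_id_mul_exp_neg_mul hr).const_mul (2 * A)
  have hc : A / (2 * π ^ 2) = 2 * A * (1 / (2 * π) ^ 2) := by field_simp
  rw [hc, ← integral_Ioi_id_mul_exp_neg_mul hr, ← integral_const_mul, ← integral_add h1 h2]
  have htanh : Continuous Real.tanh := by
    rw [funext Real.tanh_eq_sinh_div_cosh]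
    exact Real.continuous_sinh.div Real.continuous_cosh fun x ↦ (Real.cosh_pos x).ne'
  have h0 : IntegrableOn (fun ξ : ℝ ↦ ξ * gaussPoly p ξ * Real.tanh (π * ξ)) (Set.Ioi 0) := by
    refine h1.mul_bdd (c := 1) (htanh.comp (continuous_const_mul π)).aestronglyMeasurable ?_
    exact Filter.Eventually.of_forall fun x ↦ (Real.abs_tanh_lt_one _).le
  refine setIntegral_mono_on h0 (h1.add h2) measurableSet_Ioi fun ξ (hξ : 0 < ξ) ↦ ?_
  have ht := one_sub_two_mul_exp_neg_le_tanh (π * ξ)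
  have ht1 := Real.tanh_lt_one (π * ξ)
  rw [← mul_assoc] at ht
  have e : ξ * gaussPoly p ξ + 2 * A * (ξ * Real.exp (-(2 * π * ξ))) -
      ξ * gaussPoly p ξ * Real.tanh (π * ξ) =
      ξ * ((gaussPoly p ξ + A) * (1 - Real.tanh (π * ξ)) +
        A * (Real.tanh (π * ξ) - (1 - 2 * Real.exp (-(2 * π * ξ))))) := by ring
  have : 0 ≤ ξ * ((gaussPoly p ξ + A) * (1 - Real.tanh (π * ξ)) +
      A * (Real.tanh (π * ξ) - (1 - 2 * Real.exp (-(2 * π * ξ))))) :=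
    mul_nonneg hξ.le (add_nonneg (mul_nonneg (by linarith [hp ξ]) (by linarith))
      (mul_nonneg hA (by linarith)))
  linarith

open Polynomial in
/-- The polynomial factor of the test function. -/
noncomputable def testPoly : ℝ[X] :=
  C (-8335000) * X ^ 7 + C 243365500 * X ^ 6 + C (-2190594650) * X ^ 5 + C 14866857345 * X ^ 4
    + C (-83226417446) * X ^ 3 + C (-481090141755) * X ^ 2 + C (-3702197159920) * X
    + C (-74967943154)

open Polynomial in
/-- The polynomial factor of the Fourier transform of the test function. -/
noncomputable def testPolyFT : ℝ[X] :=
  C 8335000 * X ^ 7 + C (-515119500) * X ^ 6 + C 11158476650 * X ^ 5 + C (-97762209405) * X ^ 4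
    + C 302133736286 * X ^ 3 + C (-743349220995) * X ^ 2 + C 7146151771870 * X
    + C (-5574489565554)

lemma natDegree_testPoly : testPoly.natDegree = 7 := by
  unfold testPoly
  compute_degree!

lemma natDegree_testPolyFT : testPolyFT.natDegree = 7 := by
  unfold testPolyFT
  compute_degree!

lemma integral_testPoly_mul_cexp (z : ℂ) :
    ∫ x : ℝ, (gaussPoly testPoly x : ℂ) * Complex.exp (z * x) =
      (√(2 * π) : ℂ) * (testPolyFT.aeval (-z ^ 2) * Complex.exp (z ^ 2 / 2)) := by
  rw [integral_gaussPoly_mul_cexp, natDegree_testPoly]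
  simp only [Finset.sum_range_succ, Finset.sum_range_zero, Nat.reduceMul, Nat.reduceAdd,
    tiltedMoment_succ, tiltedMoment_zero, Nat.reduceSub, testPoly, testPolyFT]
  simp [Polynomial.coeff_X, Polynomial.coeff_C, Polynomial.coeff_X_pow]
  ring

lemma eval_testPoly_nonpos {t : ℝ} (ht : 0 ≤ t) : testPoly.eval t ≤ 0 := by
  simp only [testPoly, Polynomial.eval_add, Polynomial.eval_mul, Polynomial.eval_C,
    Polynomial.eval_pow, Polynomial.eval_X]
  have h1 : 0 ≤ (t - 1583 / 100) ^ 2 * (8335000 * t ^ 5 + 20520600 * t ^ 4 + 1503236729 / 2 * t ^ 3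
      + 378714549373 / 100 * t ^ 2) := by positivity
  nlinarith [mul_nonneg ht (sq_nonneg (t - 1583 / 100)), sq_nonneg (t - 1583 / 100)]

lemma eval_testPolyFT_eq (s : ℝ) : testPolyFT.eval s =
    2500 * ((s - 103 / 10) * (s - 218 / 10)) ^ 2 *
      (3334 * s ^ 3 + 7995 * s ^ 2 + 44050 * s - 44226) := by
  simp only [testPolyFT, Polynomial.eval_add, Polynomial.eval_mul, Polynomial.eval_C,
    Polynomial.eval_pow, Polynomial.eval_X]
  ring

lemma eval_testPolyFT_nonneg {s : ℝ} (hs : 1 ≤ s) : 0 ≤ testPolyFT.eval s := by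
  rw [eval_testPolyFT_eq]
  have : 0 ≤ 3334 * s ^ 3 + 7995 * s ^ 2 + 44050 * s - 44226 := by
    nlinarith [pow_le_pow_left₀ zero_le_one hs 2, pow_le_pow_left₀ zero_le_one hs 3]
  positivity

lemma eval_testPolyFT_ge {s : ℝ} (hs : 0 ≤ s) : -5574489565554 ≤ testPolyFT.eval s := by
  rcases le_total 1 s with h | h
  · linarith [eval_testPolyFT_nonneg h]
  · simp only [testPolyFT, Polynomial.eval_add, Polynomial.eval_mul, Polynomial.eval_C,
      Polynomial.eval_pow, Polynomial.eval_X]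
    have h2 : s ^ 2 ≤ s := by nlinarith
    have h4 : s ^ 4 ≤ s := pow_le_of_le_one hs h (by norm_num)
    have h6 : s ^ 6 ≤ s := pow_le_of_le_one hs h (by norm_num)
    have h3 : 0 ≤ s ^ 3 := by positivity
    have h5 : 0 ≤ s ^ 5 := by positivity
    have h7 : 0 ≤ s ^ 7 := by positivity
    linarith

lemma gaussPoly_testPolyFT_ge (ξ : ℝ) : -5574489565554 ≤ gaussPoly testPolyFT ξ := by
  have h := eval_testPolyFT_ge (sq_nonneg ξ)
  have h1 : Real.exp (-ξ ^ 2 / 2) ≤ 1 := Real.exp_le_one_iff.mpr (by nlinarith [sq_nonneg ξ])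
  have h0 := Real.exp_pos (-ξ ^ 2 / 2)
  unfold gaussPoly
  nlinarith

lemma exp_half_le_chord {s : ℝ} (h1 : 39 / 20 ≤ s) (h2 : s ≤ 13 / 4) :
    Real.exp (s / 2) ≤
      26513 / 10000 + (s - 39 / 20) * (10 / 13 * (50787 / 10000 - 26513 / 10000)) := by
  have e1 : Real.exp (39 / 40) ≤ 26513 / 10000 := by
    refine (Real.exp_bound' (n := 9) (by norm_num) (by norm_num) (by norm_num)).trans ?_
    norm_num [Finset.sum_range_succ, Nat.factorial]
  have e2 : Real.exp (13 / 8) ≤ 50787 / 10000 := by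
    have h : Real.exp (13 / 16) ≤ 225359 / 100000 := by
      refine (Real.exp_bound' (n := 9) (by norm_num) (by norm_num) (by norm_num)).trans ?_
      norm_num [Finset.sum_range_succ, Nat.factorial]
    rw [show (13 / 8 : ℝ) = 13 / 16 + 13 / 16 by norm_num, Real.exp_add]
    nlinarith [Real.exp_pos (13 / 16)]
  have hc := convexOn_exp.2 (Set.mem_univ (39 / 40)) (Set.mem_univ (13 / 8))
    (show 0 ≤ 10 / 13 * (13 / 4 - s) by linarith) (show 0 ≤ 10 / 13 * (s - 39 / 20) by linarith)
    (by ring)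
  simp only [smul_eq_mul] at hc
  rw [show 10 / 13 * (13 / 4 - s) * (39 / 40) + 10 / 13 * (s - 39 / 20) * (13 / 8) = s / 2 by
    ring] at hc
  have m1 := mul_le_mul_of_nonneg_left e1 (show 0 ≤ 10 / 13 * (13 / 4 - s) by linarith)
  have m2 := mul_le_mul_of_nonneg_left e2 (show 0 ≤ 10 / 13 * (s - 39 / 20) by linarith)
  linarith

lemma eval_testPolyFT_ge_exp {s : ℝ} (h1 : 39 / 20 ≤ s) (h2 : s ≤ 13 / 4) :
    2500000000000 * Real.exp (s / 2) ≤ testPolyFT.eval s := by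
  have hexp := exp_half_le_chord h1 h2
  obtain ⟨y, rfl⟩ : ∃ y, s = y + 39 / 20 := ⟨s - 39 / 20, by ring⟩
  have hy : 0 ≤ y := by linarith
  have hy' : y ≤ 13 / 10 := by linarith
  have p2 : y ^ 2 ≤ 13 / 10 * y := by nlinarith
  have p3 : y ^ 3 ≤ 169 / 100 * y := by nlinarith
  have p4 : y ^ 4 ≤ 2197 / 1000 * y := by nlinarith
  have p5 : 0 ≤ y ^ 5 := by positivity
  have p6 : y ^ 6 ≤ 13 / 10 * y ^ 5 := by nlinarith
  have p7 : 0 ≤ y ^ 7 := by positivity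
  simp only [testPolyFT, Polynomial.eval_add, Polynomial.eval_mul, Polynomial.eval_C,
    Polynomial.eval_pow, Polynomial.eval_X]
  linarith

lemma le_gaussPoly_testPolyFT_sqrt {s : ℝ} (h1 : 39 / 20 ≤ s) (h2 : s ≤ 13 / 4) :
    2500000000000 ≤ gaussPoly testPolyFT √s := by
  rw [gaussPoly, Real.sq_sqrt (by linarith), neg_div, Real.exp_neg, ← div_eq_mul_inv,
    le_div_iff₀ (Real.exp_pos _)]
  exact eval_testPolyFT_ge_exp h1 h2

lemma gaussPoly_testPolyFT_sqrt_nonneg {s : ℝ} (hs : 1 ≤ s) :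
    0 ≤ gaussPoly testPolyFT √s := by
  rw [gaussPoly, Real.sq_sqrt (by linarith)]
  exact mul_nonneg (eval_testPolyFT_nonneg hs) (Real.exp_pos _).le

lemma integral_Ioi_id_mul_gaussPoly_testPolyFT :
    ∫ ξ in Set.Ioi (0 : ℝ), ξ * gaussPoly testPolyFT ξ = 4221670116434 := by
  rw [integral_Ioi_id_mul_gaussPoly, natDegree_testPolyFT]
  simp only [Finset.sum_range_succ, Finset.sum_range_zero, testPolyFT]
  simp [Polynomial.coeff_X, Polynomial.coeff_C, Polynomial.coeff_X_pow, Nat.factorial]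
  norm_num

theorem stmt_7 :
    ∃ (u : Polynomial ℝ) (c : ℝ), 0 < c ∧
      (let f : ℝ → ℝ := gaussPoly u
      let fhat : ℝ → ℝ := evenFT f
      (∀ x : ℝ, f x ≤ 0) ∧
      (∀ lam : ℝ, lam ∈ Set.Icc (2.2 : ℝ) 3.5 → fhat (Real.sqrt (lam - 1 / 4)) ≥ c) ∧
      (∀ lam : ℝ, (3.5 : ℝ) ≤ lam → fhat (Real.sqrt (lam - 1 / 4)) ≥ 0) ∧
      (1 / c) *
          (2 * (∫ ξ in Set.Ioi (0 : ℝ), ξ * fhat ξ * Real.tanh (π * ξ))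
            - (1 / Real.sqrt (2 * π)) * ∫ x : ℝ, f x * Real.cosh (x / 2)) < 7) := by
  refine ⟨testPoly, 2500000000000, by norm_num, ?_⟩
  intro f fhat
  have hfhat : fhat = gaussPoly testPolyFT := funext (evenFT_gaussPoly integral_testPoly_mul_cexp)
  rw [hfhat]
  refine ⟨fun x ↦ mul_nonpos_of_nonpos_of_nonneg (eval_testPoly_nonpos (sq_nonneg x))
    (Real.exp_pos _).le, fun lam hlam ↦ ?_, fun lam hlam ↦ ?_, ?_⟩
  · obtain ⟨h1, h2⟩ := hlam
    exact le_gaussPoly_testPolyFT_sqrt (by norm_num at h1 ⊢; linarith)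
      (by norm_num at h2 ⊢; linarith)
  · exact gaussPoly_testPolyFT_sqrt_nonneg (by norm_num at hlam ⊢; linarith)
  · have hcosh := integral_gaussPoly_mul_cosh integral_testPoly_mul_cexp (1 / 2)
    simp_rw [one_div_mul_eq_div (2 : ℝ)] at hcosh
    have htanh := integral_Ioi_id_mul_gaussPoly_mul_tanh_le (by norm_num) gaussPoly_testPolyFT_ge
    rw [integral_Ioi_id_mul_gaussPoly_testPolyFT] at htanh
    have hpi : (5574489565554 : ℝ) / (2 * π ^ 2) ≤ 5574489565554 / (2 * 3.14 ^ 2) := by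
      gcongr
      exact Real.pi_gt_d2.le
    have hexp : Real.exp ((1 / 2) ^ 2 / 2) ≤ 1134 / 1000 := by
      refine (Real.exp_bound' (n := 5) (by norm_num) (by norm_num) (by norm_num)).trans ?_
      norm_num [Finset.sum_range_succ, Nat.factorial]
    have heval : testPolyFT.eval (-(1 / 2) ^ 2) = -15181005990530709 / 2048 := by
      simp only [testPolyFT, Polynomial.eval_add, Polynomial.eval_mul, Polynomial.eval_C,
        Polynomial.eval_pow, Polynomial.eval_X]
      norm_num
    rw [hcosh, heval, one_div_mul_eq_div, div_lt_iff₀ (by norm_num)]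
    norm_num at hpi hexp ⊢
    linarith
end

section
/- There exist a real polynomial u and a real constant c > 0 such that the even Schwartz function f(x) = u(x²) e^{−x²/2} satisfies: (i) f(x) ≤ 0 for all x ∈ ℝ; (ii) f̂(√(λ − 1/4)) ≥ c for all λ ∈ [3.5, 4]; (iii) f̂(√(λ − 1/4)) ≥ 0 for all λ ≥ 4; (iv) (1/c) · ( 2 ∫₀^∞ ξ f̂(ξ) tanh(πξ) dξ − (1/√(2π)) ∫_ℝ f(x) cosh(x/2) dx ) < 7. -/
open Real MeasureTheory

theorem integrable_pow_mul_cexp_quadratic (n : ℕ) (z : ℂ) :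
    Integrable fun x : ℝ => (x : ℂ) ^ n * Complex.exp (-(x : ℂ) ^ 2 / 2 + z * x) := by
  have h : Integrable fun x : ℝ =>
      Real.exp (z.re ^ 2) * (x ^ (n : ℝ) * Real.exp (-(1 / 4) * x ^ 2)) :=
    (integrable_rpow_mul_exp_neg_mul_sq (by norm_num) (by linarith [n.cast_nonneg (α := ℝ)])).const_mul _
  refine h.mono (by fun_prop) (Filter.Eventually.of_forall fun x => ?_)
  have hre : (-(x : ℂ) ^ 2 / 2 + z * x).re = -x ^ 2 / 2 + z.re * x := by
    have : (-(x : ℂ) ^ 2 / 2 + z * x) = ((-x ^ 2 / 2 : ℝ) : ℂ) + z * x := by push_cast; ring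
    rw [this, Complex.add_re, Complex.ofReal_re, Complex.re_mul_ofReal]
  rw [norm_mul, norm_pow, Complex.norm_real, Complex.norm_exp, hre, norm_mul, norm_mul,
    Real.rpow_natCast, norm_pow, Real.norm_of_nonneg (Real.exp_pos _).le,
    Real.norm_of_nonneg (Real.exp_pos _).le, mul_left_comm, ← Real.exp_add]
  refine mul_le_mul_of_nonneg_left (Real.exp_le_exp.mpr ?_) (by positivity)
  nlinarith [sq_nonneg (x / 2 - z.re)]

/-- The moments `∫ xⁿ e^{-x²/2 + zx} dx` of a Gaussian with complex shift. -/
noncomputable def gaussMoment (n : ℕ) (z : ℂ) : ℂ :=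
  ∫ x : ℝ, (x : ℂ) ^ n * Complex.exp (-(x : ℂ) ^ 2 / 2 + z * x)

theorem hasDerivAt_cexp_quadratic (z : ℂ) (x : ℝ) :
    HasDerivAt (fun x : ℝ => Complex.exp (-(x : ℂ) ^ 2 / 2 + z * x))
      (Complex.exp (-(x : ℂ) ^ 2 / 2 + z * x) * (-x + z)) x := by
  have h1 : HasDerivAt (fun y : ℂ => -y ^ 2 / 2 + z * y) (-x + z) x := by
    have := (((hasDerivAt_id (x : ℂ)).pow 2).neg.div_const 2).add ((hasDerivAt_id (x : ℂ)).const_mul z)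
    refine this.congr_deriv ?_
    simp
    ring
  exact h1.cexp.comp_ofReal

theorem gaussMoment_zero (z : ℂ) :
    gaussMoment 0 z = Real.sqrt (2 * π) * Complex.exp (z ^ 2 / 2) := by
  have h := integral_cexp_quadratic (b := -(1 / 2)) (by norm_num) z 0
  have h2 : ((π : ℂ) / -(-(1 / 2))) ^ (1 / 2 : ℂ) = Real.sqrt (2 * π) := by
    rw [Real.sqrt_eq_rpow, Complex.ofReal_cpow (by positivity)]
    push_cast
    congr 1
    ring
  rw [h2] at h
  rw [gaussMoment]
  convert h using 3
  · rw [pow_zero, one_mul]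
    congr 1
    ring
  · ring

theorem gaussMoment_one (z : ℂ) : gaussMoment 1 z = z * gaussMoment 0 z := by
  have h0 := integrable_pow_mul_cexp_quadratic 0 z
  have h1 := integrable_pow_mul_cexp_quadratic 1 z
  have h := integral_eq_zero_of_hasDerivAt_of_integrable
    (f := fun x : ℝ => Complex.exp (-(x : ℂ) ^ 2 / 2 + z * x))
    (fun x => hasDerivAt_cexp_quadratic z x)
    (by
      convert (h0.const_mul z).sub h1 using 2 with x
      simp only [Pi.sub_apply]
      ring)
    (by simpa using h0)
  have e : ∀ x : ℝ, Complex.exp (-(x : ℂ) ^ 2 / 2 + z * x) * (-x + z) =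
      z * ((x : ℂ) ^ 0 * Complex.exp (-(x : ℂ) ^ 2 / 2 + z * x))
        - (x : ℂ) ^ 1 * Complex.exp (-(x : ℂ) ^ 2 / 2 + z * x) := fun x => by ring
  simp_rw [e] at h
  rw [integral_sub (h0.const_mul z) h1, integral_const_mul] at h
  exact (sub_eq_zero.mp h).symm

theorem gaussMoment_add_two (n : ℕ) (z : ℂ) :
    gaussMoment (n + 2) z = z * gaussMoment (n + 1) z + (n + 1) * gaussMoment n z := by
  have h0 := integrable_pow_mul_cexp_quadratic n z
  have h1 := integrable_pow_mul_cexp_quadratic (n + 1) z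
  have h2 := integrable_pow_mul_cexp_quadratic (n + 2) z
  have e : ∀ x : ℝ, ((n + 1 : ℕ) : ℂ) * (x : ℂ) ^ n * Complex.exp (-(x : ℂ) ^ 2 / 2 + z * x)
      + (x : ℂ) ^ (n + 1) * (Complex.exp (-(x : ℂ) ^ 2 / 2 + z * x) * (-x + z)) =
      (z * ((x : ℂ) ^ (n + 1) * Complex.exp (-(x : ℂ) ^ 2 / 2 + z * x))
        + (n + 1) * ((x : ℂ) ^ n * Complex.exp (-(x : ℂ) ^ 2 / 2 + z * x)))
        - (x : ℂ) ^ (n + 2) * Complex.exp (-(x : ℂ) ^ 2 / 2 + z * x) := fun x => by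
    push_cast
    ring
  have h := integral_eq_zero_of_hasDerivAt_of_integrable
    (f := fun x : ℝ => (x : ℂ) ^ (n + 1) * Complex.exp (-(x : ℂ) ^ 2 / 2 + z * x))
    (f' := fun x : ℝ => (z * ((x : ℂ) ^ (n + 1) * Complex.exp (-(x : ℂ) ^ 2 / 2 + z * x))
        + (n + 1) * ((x : ℂ) ^ n * Complex.exp (-(x : ℂ) ^ 2 / 2 + z * x)))
        - (x : ℂ) ^ (n + 2) * Complex.exp (-(x : ℂ) ^ 2 / 2 + z * x))
    (fun x => by
      rw [← e x]
      have hp : HasDerivAt (fun x : ℝ => (x : ℂ) ^ (n + 1)) (((n + 1 : ℕ) : ℂ) * (x : ℂ) ^ n) x := by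
        simpa using (hasDerivAt_pow (n + 1) (x : ℂ)).comp_ofReal
      exact hp.mul (hasDerivAt_cexp_quadratic z x))
    (((h1.const_mul z).add (h0.const_mul _)).sub h2) h1
  rw [integral_sub (f := fun x : ℝ => z * ((x : ℂ) ^ (n + 1) *
      Complex.exp (-(x : ℂ) ^ 2 / 2 + z * x)) + (n + 1) * ((x : ℂ) ^ n *
      Complex.exp (-(x : ℂ) ^ 2 / 2 + z * x))) ((h1.const_mul z).add (h0.const_mul _)) h2,
    integral_add (h1.const_mul z) (h0.const_mul _), integral_const_mul, integral_const_mul] at h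
  exact (sub_eq_zero.mp h).symm

/-- The polynomials `e_k` with `(x^{2k} e^{-x²/2})^ = e_k(ξ²) e^{-ξ²/2}`. -/
def evenMomentPoly : ℕ → ℝ → ℝ
  | 0, _ => 1
  | 1, t => 1 - t
  | k + 2, t => (4 * k + 5 - t) * evenMomentPoly (k + 1) t
      - (2 * k + 2) * (2 * k + 1) * evenMomentPoly k t

theorem gaussMoment_two_mul {z : ℂ} {t : ℝ} (hz : z ^ 2 = -(t : ℂ)) (k : ℕ) :
    gaussMoment (2 * k) z = Real.sqrt (2 * π) * Real.exp (-t / 2) * evenMomentPoly k t := by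
  have h0 : gaussMoment 0 z = Real.sqrt (2 * π) * Real.exp (-t / 2) := by
    rw [gaussMoment_zero, hz]
    push_cast
    rfl
  induction k using Nat.twoStepInduction with
  | zero => simp [h0, evenMomentPoly]
  | one =>
    have h := gaussMoment_add_two 0 z
    rw [gaussMoment_one] at h
    simp only [mul_one, evenMomentPoly]
    rw [show 2 = 0 + 2 from rfl, h, h0]
    simp only [Complex.ofReal_sub, Complex.ofReal_one, CharP.cast_eq_zero]
    linear_combination (Real.sqrt (2 * π) * Real.exp (-t / 2) : ℂ) * hz
  | more k ih1 ih2 =>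
    have a2 := gaussMoment_add_two (2 * k) z
    have a3 := gaussMoment_add_two (2 * k + 1) z
    have a4 := gaussMoment_add_two (2 * k + 2) z
    rw [show 2 * (k + 1) = 2 * k + 2 by ring] at ih2
    rw [show 2 * (k + 2) = 2 * k + 2 + 2 by ring]
    simp only [evenMomentPoly]
    push_cast at a2 a3 a4 ih1 ih2 ⊢
    rw [show 2 * k + 2 + 1 = 2 * k + 1 + 2 by ring] at a4
    rw [show 2 * k + 1 + 1 = 2 * k + 2 by ring] at a3
    have key : gaussMoment (2 * k + 2 + 2) z = (z ^ 2 + 4 * k + 5) * gaussMoment (2 * k + 2) z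
        - (2 * k + 2) * (2 * k + 1) * gaussMoment (2 * k) z := by
      linear_combination a4 + z * a3 - (2 * k + 2 : ℂ) * a2
    rw [key, ih1, ih2, hz]
    ring

theorem integral_gaussPoly_mul_cosh_s8 {n : ℕ} (a : Fin n → ℝ) {z : ℂ} {t : ℝ}
    (hz : z ^ 2 = -(t : ℂ)) :
    ∫ x : ℝ, (gaussPoly (∑ k, Polynomial.C (a k) * Polynomial.X ^ (k : ℕ)) x : ℂ)
        * Complex.cosh (z * x) =
      Real.sqrt (2 * π) * Real.exp (-t / 2) * ∑ k, a k * evenMomentPoly k t := by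
  have hz' : (-z) ^ 2 = -(t : ℂ) := by rw [neg_sq, hz]
  have e : ∀ x : ℝ, (gaussPoly (∑ k, Polynomial.C (a k) * Polynomial.X ^ (k : ℕ)) x : ℂ)
        * Complex.cosh (z * x) =
      ∑ k, (a k / 2 : ℂ) * ((x : ℂ) ^ (2 * (k : ℕ)) * Complex.exp (-(x : ℂ) ^ 2 / 2 + z * x)
        + (x : ℂ) ^ (2 * (k : ℕ)) * Complex.exp (-(x : ℂ) ^ 2 / 2 + (-z) * x)) := fun x => by
    simp only [gaussPoly, Polynomial.eval_finsetSum, Polynomial.eval_mul, Polynomial.eval_C,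
      Polynomial.eval_pow, Polynomial.eval_X, Complex.cosh, Complex.exp_add]
    push_cast
    rw [Finset.sum_mul, Finset.sum_mul]
    refine Finset.sum_congr rfl fun k _ => ?_
    rw [← pow_mul, neg_mul z]
    ring
  have hi : ∀ k : Fin n, Integrable fun x : ℝ => (a k / 2 : ℂ) *
      ((x : ℂ) ^ (2 * (k : ℕ)) * Complex.exp (-(x : ℂ) ^ 2 / 2 + z * x)
        + (x : ℂ) ^ (2 * (k : ℕ)) * Complex.exp (-(x : ℂ) ^ 2 / 2 + (-z) * x)) := fun k =>
    ((integrable_pow_mul_cexp_quadratic _ _).add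
      (integrable_pow_mul_cexp_quadratic _ _)).const_mul _
  simp_rw [e]
  rw [integral_finsetSum _ fun k _ => hi k]
  push_cast
  rw [Finset.mul_sum]
  refine Finset.sum_congr rfl fun k _ => ?_
  rw [integral_const_mul, integral_add (integrable_pow_mul_cexp_quadratic _ _)
    (integrable_pow_mul_cexp_quadratic _ _)]
  change _ * (gaussMoment _ _ + gaussMoment _ _) = _
  rw [gaussMoment_two_mul hz, gaussMoment_two_mul hz']
  push_cast
  ring

theorem evenFT_gaussPoly_s8 {n : ℕ} (a : Fin n → ℝ) (ξ : ℝ) :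
    evenFT (gaussPoly (∑ k, Polynomial.C (a k) * Polynomial.X ^ (k : ℕ))) ξ =
      (∑ k, a k * evenMomentPoly k (ξ ^ 2)) * Real.exp (-ξ ^ 2 / 2) := by
  have h := integral_gaussPoly_mul_cosh_s8 a (z := ξ * Complex.I) (t := ξ ^ 2)
    (by rw [mul_pow, Complex.I_sq]; push_cast; ring)
  have e : ∀ x : ℝ, Complex.cosh (ξ * Complex.I * x) = (Real.cos (ξ * x) : ℂ) := fun x => by
    rw [mul_right_comm, Complex.cosh_mul_I]
    push_cast
    rfl
  simp_rw [e, ← Complex.ofReal_mul] at h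
  rw [integral_complex_ofReal, Complex.ofReal_inj] at h
  have hs : Real.sqrt (2 * π) ≠ 0 := by positivity
  rw [evenFT, h]
  field_simp

theorem integral_gaussPoly_mul_cosh_half {n : ℕ} (a : Fin n → ℝ) :
    (1 / Real.sqrt (2 * π)) *
      ∫ x : ℝ, gaussPoly (∑ k, Polynomial.C (a k) * Polynomial.X ^ (k : ℕ)) x * Real.cosh (x / 2) =
      (∑ k, a k * evenMomentPoly k (-1 / 4)) * Real.exp (1 / 8) := by
  have h := integral_gaussPoly_mul_cosh_s8 a (z := 1 / 2) (t := -1 / 4) (by push_cast; norm_num)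
  have e : ∀ x : ℝ, Complex.cosh (1 / 2 * x) = (Real.cosh (x / 2) : ℂ) := fun x => by
    push_cast
    congr 1
    ring
  simp_rw [e, ← Complex.ofReal_mul] at h
  rw [integral_complex_ofReal, Complex.ofReal_inj] at h
  have hs : Real.sqrt (2 * π) ≠ 0 := by positivity
  rw [h, show -(-1 / 4) / 2 = (1 / 8 : ℝ) by norm_num]
  field_simp

theorem integrableOn_pow_mul_exp_neg_sq_div_two (n : ℕ) :
    IntegrableOn (fun x : ℝ => x ^ n * Real.exp (-x ^ 2 / 2)) (Set.Ioi 0) := by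
  have h := integrable_rpow_mul_exp_neg_mul_sq (b := 1 / 2) (by norm_num) (s := n)
    (by linarith [n.cast_nonneg (α := ℝ)])
  refine (h.congr (Filter.Eventually.of_forall fun x => ?_)).integrableOn
  simp only [Real.rpow_natCast]
  congr 2
  ring

theorem integral_pow_odd_mul_exp_neg_sq_div_two (k : ℕ) :
    ∫ x in Set.Ioi (0 : ℝ), x ^ (2 * k + 1) * Real.exp (-x ^ 2 / 2) =
      2 ^ k * (k.factorial : ℝ) := by
  have h := integral_rpow_mul_exp_neg_mul_rpow (p := 2) (q := (2 * k + 1 : ℕ)) (b := 1 / 2)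
    (by norm_num) (by linarith [(2 * k + 1).cast_nonneg (α := ℝ)]) (by norm_num)
  have e : (((2 * k + 1 : ℕ) : ℝ) + 1) / 2 = (k + 1 : ℕ) := by push_cast; ring
  rw [neg_div, e, Real.rpow_neg (by norm_num), Real.rpow_natCast, Nat.cast_succ k,
    Real.Gamma_nat_eq_factorial] at h
  calc _ = ∫ x in Set.Ioi (0 : ℝ), x ^ ((2 * k + 1 : ℕ) : ℝ) * Real.exp (-(1 / 2) * x ^ (2 : ℝ)) := by
        congr 1
        ext x
        rw [Real.rpow_natCast, Real.rpow_two]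
        congr 2
        ring
    _ = _ := by
        rw [h, one_div, inv_pow, inv_inv, pow_succ]
        ring

theorem integrableOn_pow_mul_exp_neg_mul (n : ℕ) {r : ℝ} (hr : 0 < r) :
    IntegrableOn (fun x : ℝ => x ^ n * Real.exp (-(r * x))) (Set.Ioi 0) := by
  have h := integrableOn_rpow_mul_exp_neg_mul_rpow (s := n) (p := 1)
    (by linarith [n.cast_nonneg (α := ℝ)]) one_pos hr
  refine h.congr (Filter.Eventually.of_forall fun x => ?_)
  simp only [Real.rpow_natCast, Real.rpow_one, neg_mul]

theorem integral_pow_mul_exp_neg_mul (n : ℕ) {r : ℝ} (hr : 0 < r) :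
    ∫ x in Set.Ioi (0 : ℝ), x ^ n * Real.exp (-(r * x)) = n.factorial / r ^ (n + 1) := by
  have h := Real.integral_rpow_mul_exp_neg_mul_Ioi (a := (n + 1 : ℕ)) (by positivity) hr
  rw [Real.rpow_natCast, Nat.cast_succ, Real.Gamma_nat_eq_factorial, add_sub_cancel_right] at h
  simp_rw [Real.rpow_natCast] at h
  rw [h, one_div, inv_pow]
  ring

/-- An exponential sum dominating `1 - tanh (π x)` for `x ≥ 0`. -/
noncomputable def tanhDefectBound (x : ℝ) : ℝ :=
  2 * Real.exp (-(2 * π * x)) - 2 * Real.exp (-(4 * π * x)) + 2 * Real.exp (-(6 * π * x))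
    - 3 / 2 * Real.exp (-(8 * π * x)) + 1 / 2 * Real.exp (-(10 * π * x))

theorem one_sub_tanh_le_tanhDefectBound (x : ℝ) :
    1 - Real.tanh (π * x) ≤ tanhDefectBound x := by
  set y := Real.exp (-(2 * π * x)) with hy
  have hy0 : 0 < y := Real.exp_pos _
  have hpow : ∀ n : ℕ, Real.exp (-(2 * n * π * x)) = y ^ n := fun n => by
    rw [hy, ← Real.exp_nat_mul]
    congr 1
    ring
  have h2 := hpow 2
  have h3 := hpow 3
  have h4 := hpow 4
  have h5 := hpow 5
  norm_num at h2 h3 h4 h5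
  have ht : 1 - Real.tanh (π * x) = 2 * y / (1 + y) := by
    have hinv : Real.exp (-(π * x)) = Real.exp (π * x) * y := by
      rw [hy, ← Real.exp_add]
      congr 1
      ring
    have := Real.exp_pos (π * x)
    rw [Real.tanh_eq, hinv]
    field_simp
    ring
  rw [ht, div_le_iff₀ (by positivity), tanhDefectBound, ← hy, h2, h3, h4, h5]
  have : 0 ≤ y ^ 4 * (1 - y) ^ 2 := by positivity
  linarith

theorem tanhDefectBound_nonneg (x : ℝ) : 0 ≤ tanhDefectBound x :=
  (sub_nonneg.mpr (Real.tanh_lt_one _).le).trans (one_sub_tanh_le_tanhDefectBound x)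

/-- The moments `∫₀^∞ xⁿ G(x) dx` of `G = tanhDefectBound`. -/
noncomputable def tanhDefectMoment (n : ℕ) : ℝ :=
  n.factorial / π ^ (n + 1) * (2 / 2 ^ (n + 1) - 2 / 4 ^ (n + 1) + 2 / 6 ^ (n + 1)
    - 3 / 2 / 8 ^ (n + 1) + 1 / 2 / 10 ^ (n + 1))

theorem integral_pow_mul_tanhDefectBound (n : ℕ) :
    IntegrableOn (fun x : ℝ => x ^ n * tanhDefectBound x) (Set.Ioi 0) ∧
    ∫ x in Set.Ioi (0 : ℝ), x ^ n * tanhDefectBound x = tanhDefectMoment n := by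
  have hi : ∀ c : ℝ, 0 < c →
      IntegrableOn (fun x : ℝ => x ^ n * Real.exp (-(c * π * x))) (Set.Ioi 0) := fun c hc =>
    integrableOn_pow_mul_exp_neg_mul n (by positivity)
  have hv : ∀ c : ℝ, 0 < c → ∫ x in Set.Ioi (0 : ℝ), x ^ n * Real.exp (-(c * π * x)) =
      n.factorial / π ^ (n + 1) / c ^ (n + 1) := fun c hc => by
    rw [integral_pow_mul_exp_neg_mul n (by positivity), mul_pow]
    field_simp
  have i2 := (hi 2 (by norm_num)).const_mul 2
  have i4 := (hi 4 (by norm_num)).const_mul 2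
  have i6 := (hi 6 (by norm_num)).const_mul 2
  have i8 := (hi 8 (by norm_num)).const_mul (3 / 2)
  have i10 := (hi 10 (by norm_num)).const_mul (1 / 2)
  have e : (fun x : ℝ => x ^ n * tanhDefectBound x) = fun x =>
      2 * (x ^ n * Real.exp (-(2 * π * x))) - 2 * (x ^ n * Real.exp (-(4 * π * x)))
      + 2 * (x ^ n * Real.exp (-(6 * π * x))) - 3 / 2 * (x ^ n * Real.exp (-(8 * π * x)))
      + 1 / 2 * (x ^ n * Real.exp (-(10 * π * x))) := by
    ext x
    rw [tanhDefectBound]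
    ring
  have j24 : IntegrableOn (fun x : ℝ => 2 * (x ^ n * Real.exp (-(2 * π * x)))
      - 2 * (x ^ n * Real.exp (-(4 * π * x)))) (Set.Ioi 0) := Integrable.sub i2 i4
  have j246 : IntegrableOn (fun x : ℝ => 2 * (x ^ n * Real.exp (-(2 * π * x)))
      - 2 * (x ^ n * Real.exp (-(4 * π * x))) + 2 * (x ^ n * Real.exp (-(6 * π * x))))
      (Set.Ioi 0) := Integrable.add j24 i6
  have j2468 : IntegrableOn (fun x : ℝ => 2 * (x ^ n * Real.exp (-(2 * π * x)))
      - 2 * (x ^ n * Real.exp (-(4 * π * x))) + 2 * (x ^ n * Real.exp (-(6 * π * x)))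
      - 3 / 2 * (x ^ n * Real.exp (-(8 * π * x)))) (Set.Ioi 0) := Integrable.sub j246 i8
  rw [e]
  refine ⟨Integrable.add j2468 i10, ?_⟩
  rw [integral_add j2468 i10, integral_sub j246 i8, integral_add j24 i6, integral_sub i2 i4]
  simp only [integral_const_mul]
  rw [hv 2 (by norm_num), hv 4 (by norm_num), hv 6 (by norm_num), hv 8 (by norm_num),
    hv 10 (by norm_num), tanhDefectMoment]
  ring

theorem continuous_tanh : Continuous Real.tanh := by
  simp_rw [funext Real.tanh_eq_sinh_div_cosh]
  exact Real.continuous_sinh.div Real.continuous_cosh fun x => (Real.cosh_pos x).ne'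

theorem integral_mul_tanh_le {n m : ℕ} (b : Fin n → ℝ) (s : Fin m → ℝ) {F : ℝ → ℝ}
    (hF : ∀ x, F x = (∑ k, b k * (x ^ 2) ^ (k : ℕ)) * Real.exp (-x ^ 2 / 2))
    (hs : ∀ t : ℝ, 0 ≤ t → 0 ≤ ∑ k, s k * t ^ (k : ℕ))
    (hFs : ∀ x : ℝ, 0 < x → 0 ≤ F x + ∑ k, s k * (x ^ 2) ^ (k : ℕ)) :
    ∫ x in Set.Ioi (0 : ℝ), x * F x * Real.tanh (π * x) ≤
      ∑ k : Fin n, b k * (2 ^ (k : ℕ) * ((k : ℕ).factorial : ℝ)) +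
      ∑ k : Fin m, s k * tanhDefectMoment (2 * (k : ℕ) + 1) := by
  have e1 : (fun x => x * F x) = fun x => ∑ k : Fin n, b k *
      (x ^ (2 * (k : ℕ) + 1) * Real.exp (-x ^ 2 / 2)) := by
    ext x
    rw [hF, Finset.sum_mul, Finset.mul_sum]
    refine Finset.sum_congr rfl fun k _ => ?_
    rw [← pow_mul]
    ring
  have e2 : (fun x => x * (∑ k, s k * (x ^ 2) ^ (k : ℕ)) * tanhDefectBound x) =
      fun x => ∑ k : Fin m, s k * (x ^ (2 * (k : ℕ) + 1) * tanhDefectBound x) := by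
    ext x
    rw [Finset.mul_sum, Finset.sum_mul]
    refine Finset.sum_congr rfl fun k _ => ?_
    rw [← pow_mul]
    ring
  have i1' : ∀ k : Fin n, IntegrableOn (fun x : ℝ => b k *
      (x ^ (2 * (k : ℕ) + 1) * Real.exp (-x ^ 2 / 2))) (Set.Ioi 0) := fun k =>
    (integrableOn_pow_mul_exp_neg_sq_div_two _).const_mul _
  have i2' : ∀ k : Fin m, IntegrableOn (fun x : ℝ => s k *
      (x ^ (2 * (k : ℕ) + 1) * tanhDefectBound x)) (Set.Ioi 0) := fun k =>
    (integral_pow_mul_tanhDefectBound _).1.const_mul _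
  have i1 : IntegrableOn (fun x => x * F x) (Set.Ioi 0) := by
    rw [e1]
    exact integrable_finsetSum _ fun k _ => i1' k
  have i2 : IntegrableOn (fun x => x * (∑ k, s k * (x ^ 2) ^ (k : ℕ)) * tanhDefectBound x)
      (Set.Ioi 0) := by
    rw [e2]
    exact integrable_finsetSum _ fun k _ => i2' k
  have v1 : ∫ x in Set.Ioi (0 : ℝ), x * F x =
      ∑ k : Fin n, b k * (2 ^ (k : ℕ) * ((k : ℕ).factorial : ℝ)) := by
    rw [e1, integral_finsetSum _ fun k _ => i1' k]
    simp_rw [integral_const_mul, integral_pow_odd_mul_exp_neg_sq_div_two]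
  have v2 : ∫ x in Set.Ioi (0 : ℝ), x * (∑ k, s k * (x ^ 2) ^ (k : ℕ)) * tanhDefectBound x =
      ∑ k : Fin m, s k * tanhDefectMoment (2 * (k : ℕ) + 1) := by
    rw [e2, integral_finsetSum _ fun k _ => i2' k]
    simp_rw [integral_const_mul, (integral_pow_mul_tanhDefectBound _).2]
  rw [← v1, ← v2, ← integral_add i1 i2]
  refine setIntegral_mono_on ?_ (i1.add i2) measurableSet_Ioi fun x hx => ?_
  · refine i1.mul_bdd (c := 1) (continuous_tanh.comp (continuous_const.mul
      continuous_id)).aestronglyMeasurable (Filter.Eventually.of_forall fun x => ?_)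
    exact abs_le.mpr ⟨(Real.neg_one_lt_tanh _).le, (Real.tanh_lt_one _).le⟩
  · have hx : 0 < x := hx
    have hS := hs (x ^ 2) (by positivity)
    have hFS := hFs x hx
    have hg := sub_nonneg.mpr (Real.tanh_lt_one (π * x)).le
    have hG := one_sub_tanh_le_tanhDefectBound x
    have h1 := mul_nonneg hFS hg
    have h2 := mul_le_mul_of_nonneg_left hG hS
    have h3 := mul_nonneg hx.le (by nlinarith : 0 ≤ F x * (1 - Real.tanh (π * x)) +
      (∑ k, s k * (x ^ 2) ^ (k : ℕ)) * tanhDefectBound x)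
    linarith

/-- Coefficients of the extremal polynomial `u`. -/
def extremalCoeff : Fin 14 → ℝ :=
  ![0,
    -37284318839095826046497155166572224300817640816516207416876264080,
    -3679222184646757215452179564006682817065094416292476247509566920,
    -41374880066883303833129856948530796938342435134276547665118625,
    87099593364600358346117663057713135806384807268153484909936922,
    -7163557455076080967269598620183666968362589579380519616472261,
    1544872631249277460580159097029361186630859603472253805934952,
    -191055483850260789566983123762501060378336177903988083426554,
    19563591979804862050317882377944175137035413578651834955340,
    -1999172496311292752055928404778183261469647251323069638506,
    139668648609529458774766312986278696558453897198582309808,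
    -6341863727876178669325852364437163242603758579086778421,
    155126241904677809785792558889288899867733818373904362,
    -1473310088186163405905906347260019901966867241410065]

/-- Coefficients of the polynomial `v` with `f̂(ξ) = v(ξ²) e^{-ξ²/2}`. -/
def dualCoeff : Fin 14 → ℝ :=
  ![-43903178103807019595231736468495262043747310636882643478670336000,
    53081699562372348313993643927403166547199258647119202825942016000,
    -16096258516820047522584696342186999610742158033444323549919380480,
    8874443731029657578143070989617063196326696872041288052057385984,
    -1984263536226218038742629987787342876774037607133703804037567968,
    307633051962661851689571371580676055545861431854356805666097696,
    -55981076229786501077890226694947668664616422191513057297049952,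
    8325232401588501409637233888454754832378346963955999114334944,
    -769880639451382711769441969665793009066699394410630918067558,
    43123883329922254865251363290910843971595563089101786884426,
    -1468190257139054607613762665871070192946873347294729227857,
    29604978417334531923327005785605319482323220485130589759,
    -323699536755825297133627003970217568271498035084366763,
    1473310088186163405905906347260019901966867241410065]

theorem sum_extremalCoeff_mul_evenMomentPoly (t : ℝ) :
    ∑ k, extremalCoeff k * evenMomentPoly k t = ∑ k, dualCoeff k * t ^ (k : ℕ) := by
  have h0 : evenMomentPoly 0 t = 1 := rfl
  have h1 : evenMomentPoly 1 t = 1 - t := rfl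
  have h2 : evenMomentPoly 2 t = 3 - 6 * t + 1 * t ^ 2 := by
    rw [evenMomentPoly, h1, h0]
    push_cast
    ring
  have h3 : evenMomentPoly 3 t = 15 - 45 * t + 15 * t ^ 2 - 1 * t ^ 3 := by
    rw [evenMomentPoly, h2, h1]
    push_cast
    ring
  have h4 : evenMomentPoly 4 t = 105 - 420 * t + 210 * t ^ 2 - 28 * t ^ 3 + 1 * t ^ 4 := by
    rw [evenMomentPoly, h3, h2]
    push_cast
    ring
  have h5 : evenMomentPoly 5 t = 945 - 4725 * t + 3150 * t ^ 2 - 630 * t ^ 3 + 45 * t ^ 4 - 1 * t ^ 5 := by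
    rw [evenMomentPoly, h4, h3]
    push_cast
    ring
  have h6 : evenMomentPoly 6 t = 10395 - 62370 * t + 51975 * t ^ 2 - 13860 * t ^ 3 + 1485 * t ^ 4
      - 66 * t ^ 5 + 1 * t ^ 6 := by
    rw [evenMomentPoly, h5, h4]
    push_cast
    ring
  have h7 : evenMomentPoly 7 t = 135135 - 945945 * t + 945945 * t ^ 2 - 315315 * t ^ 3 + 45045 * t ^ 4
      - 3003 * t ^ 5 + 91 * t ^ 6 - 1 * t ^ 7 := by
    rw [evenMomentPoly, h6, h5]
    push_cast
    ring
  have h8 : evenMomentPoly 8 t = 2027025 - 16216200 * t + 18918900 * t ^ 2 - 7567560 * t ^ 3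
      + 1351350 * t ^ 4 - 120120 * t ^ 5 + 5460 * t ^ 6 - 120 * t ^ 7
      + 1 * t ^ 8 := by
    rw [evenMomentPoly, h7, h6]
    push_cast
    ring
  have h9 : evenMomentPoly 9 t = 34459425 - 310134825 * t + 413513100 * t ^ 2 - 192972780 * t ^ 3
      + 41351310 * t ^ 4 - 4594590 * t ^ 5 + 278460 * t ^ 6 - 9180 * t ^ 7
      + 153 * t ^ 8 - 1 * t ^ 9 := by
    rw [evenMomentPoly, h8, h7]
    push_cast
    ring
  have h10 : evenMomentPoly 10 t = 654729075 - 6547290750 * t + 9820936125 * t ^ 2 - 5237832600 * t ^ 3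
      + 1309458150 * t ^ 4 - 174594420 * t ^ 5 + 13226850 * t ^ 6
      - 581400 * t ^ 7 + 14535 * t ^ 8 - 190 * t ^ 9 + 1 * t ^ 10 := by
    rw [evenMomentPoly, h9, h8]
    push_cast
    ring
  have h11 : evenMomentPoly 11 t = 13749310575 - 151242416325 * t + 252070693875 * t ^ 2 - 151242416325 * t ^ 3
      + 43212118950 * t ^ 4 - 6721885170 * t ^ 5 + 611080470 * t ^ 6
      - 33575850 * t ^ 7 + 1119195 * t ^ 8 - 21945 * t ^ 9 + 231 * t ^ 10
      - 1 * t ^ 11 := by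
    rw [evenMomentPoly, h10, h9]
    push_cast
    ring
  have h12 : evenMomentPoly 12 t = 316234143225 - 3794809718700 * t + 6957151150950 * t ^ 2 - 4638100767300 * t ^ 3
      + 1490818103775 * t ^ 4 - 265034329560 * t ^ 5 + 28109701620 * t ^ 6
      - 1853386920 * t ^ 7 + 77224455 * t ^ 8 - 2018940 * t ^ 9
      + 31878 * t ^ 10 - 276 * t ^ 11 + 1 * t ^ 12 := by
    rw [evenMomentPoly, h11, h10]
    push_cast
    ring
  have h13 : evenMomentPoly 13 t = 7905853580625 - 102776096548125 * t + 205552193096250 * t ^ 2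
      - 150738274937250 * t ^ 3 + 53835098191875 * t ^ 4 - 10767019638375 * t ^ 5
      + 1305093289500 * t ^ 6 - 100391791500 * t ^ 7 + 5019589575 * t ^ 8
      - 164038875 * t ^ 9 + 3453450 * t ^ 10 - 44850 * t ^ 11
      + 325 * t ^ 12 - 1 * t ^ 13 := by
    rw [evenMomentPoly, h12, h11]
    push_cast
    ring
  simp only [Fin.sum_univ_succ, Fin.sum_univ_zero, extremalCoeff, dualCoeff, Fin.val_zero,
    Fin.val_succ, Matrix.cons_val_zero, Matrix.cons_val_succ, Nat.reduceAdd, zero_add,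
    h0, h1, h2, h3, h4, h5, h6, h7, h8, h9, h10, h11, h12, h13]
  ring

theorem sum_extremalCoeff_nonpos {t : ℝ} (ht : 0 ≤ t) : ∑ k, extremalCoeff k * t ^ (k : ℕ) ≤ 0 := by
  have h : ∑ k, extremalCoeff k * t ^ (k : ℕ) = -(t * ((t - 12) * (t - 37)) ^ 2 *
      (189129934862713183013235305406279037318488966076800824896905
      + 60408265919939195452500173346546020457284241884923269927480 * t
      + 10387808370930798623446688986903404174454103555943409400940 * t ^ 2
      + 937153393987939440027791260517882431446646953240757603848 * t ^ 3
      + 98948717269190980747171868925349514868846440791840001742 * t ^ 4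
      + 3225607682882409834249721791946266414828254634622633320 * t ^ 5
      + 443445228113375218613980176233876736486611007948711420 * t ^ 6
      - 10741853262433796007013736857806949474980828715717992 * t ^ 7
      + 1473310088186163405905906347260019901966867241410065 * t ^ 8)) := by
    simp only [Fin.sum_univ_succ, Fin.sum_univ_zero, extremalCoeff, Fin.val_zero,
      Fin.val_succ, Matrix.cons_val_zero, Matrix.cons_val_succ]
    ring
  have hq : 0 ≤ t ^ 6 * (t - 4) ^ 2 := by positivity
  have p1 := pow_nonneg ht 1
  have p2 := pow_nonneg ht 2
  have p3 := pow_nonneg ht 3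
  have p4 := pow_nonneg ht 4
  have p5 := pow_nonneg ht 5
  have p6 := pow_nonneg ht 6
  have p7 := pow_nonneg ht 7
  rw [h]
  refine neg_nonpos.mpr (mul_nonneg (by positivity) ?_)
  linarith

theorem sum_dualCoeff_eq (t : ℝ) : ∑ k, dualCoeff k * t ^ (k : ℕ) =
    -43903178103807019595231736468495262043747310636882643478670336000
      + 53081699562372348313993643927403166547199258647119202825942016000 * t
      - 16096258516820047522584696342186999610742158033444323549919380480 * t ^ 2
      + 8874443731029657578143070989617063196326696872041288052057385984 * t ^ 3
      - 1984263536226218038742629987787342876774037607133703804037567968 * t ^ 4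
      + 307633051962661851689571371580676055545861431854356805666097696 * t ^ 5
      - 55981076229786501077890226694947668664616422191513057297049952 * t ^ 6
      + 8325232401588501409637233888454754832378346963955999114334944 * t ^ 7
      - 769880639451382711769441969665793009066699394410630918067558 * t ^ 8
      + 43123883329922254865251363290910843971595563089101786884426 * t ^ 9
      - 1468190257139054607613762665871070192946873347294729227857 * t ^ 10
      + 29604978417334531923327005785605319482323220485130589759 * t ^ 11
      - 323699536755825297133627003970217568271498035084366763 * t ^ 12
      + 1473310088186163405905906347260019901966867241410065 * t ^ 13 := by
  simp only [Fin.sum_univ_succ, Fin.sum_univ_zero, dualCoeff, Fin.val_zero,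
    Fin.val_succ, Matrix.cons_val_zero, Matrix.cons_val_succ]
  ring

theorem sum_dualCoeff_nonneg {t : ℝ} (ht : 1 ≤ t) : 0 ≤ ∑ k, dualCoeff k * t ^ (k : ℕ) := by
  have h : ∑ k, dualCoeff k * t ^ (k : ℕ) = ((t - 12) * (t - 18) * (t - 30) * (t - 52)) ^ 2 *
      (-386668915629283696051064634621606645865942493647063710 + 319449161620832566190319601918008298381279284416916786 * t
      + 4449112959890264313864595560278670377301769159748439 * t ^ 2
      + 58004355538190281610785982378764530861509385749930247 * t ^ 3
      + 6321922997875305789296017816026889769080226991487797 * t ^ 4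
      + 1473310088186163405905906347260019901966867241410065 * t ^ 5) := by
    rw [sum_dualCoeff_eq]
    ring
  have p2 := one_le_pow₀ ht (n := 2)
  have p3 := one_le_pow₀ ht (n := 3)
  have p4 := one_le_pow₀ ht (n := 4)
  have p5 := one_le_pow₀ ht (n := 5)
  rw [h]
  refine mul_nonneg (by positivity) ?_
  linarith

theorem sum_dualCoeff_ge {s : ℝ} (hs : 0 ≤ s) (hs' : s ≤ 1 / 4) :
    (∑ k, dualCoeff k * (15 / 4 : ℝ) ^ (k : ℕ)) * (1 - s + s ^ 2 / 2) ≤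
      ∑ k, dualCoeff k * (15 / 4 - 2 * s) ^ (k : ℕ) := by
  have hp : ∀ n : ℕ, 0 ≤ s ^ n ∧ s ^ (n + 1) ≤ (1 / 4) ^ n * s := fun n => by
    refine ⟨by positivity, ?_⟩
    rw [pow_succ]
    gcongr
  have q2 := mul_nonneg hs (hp 2).1
  have r2 := mul_le_mul_of_nonneg_left (hp 1).2 hs
  have q3 := mul_nonneg hs (hp 3).1
  have r3 := mul_le_mul_of_nonneg_left (hp 2).2 hs
  have q4 := mul_nonneg hs (hp 4).1
  have r4 := mul_le_mul_of_nonneg_left (hp 3).2 hs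
  have q5 := mul_nonneg hs (hp 5).1
  have r5 := mul_le_mul_of_nonneg_left (hp 4).2 hs
  have q6 := mul_nonneg hs (hp 6).1
  have r6 := mul_le_mul_of_nonneg_left (hp 5).2 hs
  have q7 := mul_nonneg hs (hp 7).1
  have r7 := mul_le_mul_of_nonneg_left (hp 6).2 hs
  have q8 := mul_nonneg hs (hp 8).1
  have r8 := mul_le_mul_of_nonneg_left (hp 7).2 hs
  have q9 := mul_nonneg hs (hp 9).1
  have r9 := mul_le_mul_of_nonneg_left (hp 8).2 hs
  have q10 := mul_nonneg hs (hp 10).1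
  have r10 := mul_le_mul_of_nonneg_left (hp 9).2 hs
  have q11 := mul_nonneg hs (hp 11).1
  have r11 := mul_le_mul_of_nonneg_left (hp 10).2 hs
  have q12 := mul_nonneg hs (hp 12).1
  have r12 := mul_le_mul_of_nonneg_left (hp 11).2 hs
  have q13 := mul_nonneg hs (hp 13).1
  have r13 := mul_le_mul_of_nonneg_left (hp 12).2 hs
  have hlin : 0 ≤ s * (1 / 4 - s) := mul_nonneg hs (by linarith)
  rw [sum_dualCoeff_eq, sum_dualCoeff_eq]
  ring_nf at *
  linarith

/-- Coefficients of a polynomial `S ≥ 0` with `f̂(ξ) ≥ -S(ξ²)`. -/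
def minorantCoeff : Fin 3 → ℝ :=
  ![43925129692858923105029352336729509674769184292201084800409674327,
    -69722428083903052547665638629729380436141562368573150476840752900,
    27667630192025020852248269297511658903230778717687758125730457500]

theorem sum_minorantCoeff (t : ℝ) :
    ∑ k, minorantCoeff k * t ^ (k : ℕ) = 11067052076810008340899307719004663561292311487075103250292183 * (63 - 50 * t) ^ 2 := by
  simp only [Fin.sum_univ_succ, Fin.sum_univ_zero, minorantCoeff, Fin.val_zero,
    Fin.val_succ, Matrix.cons_val_zero, Matrix.cons_val_succ]
  ring

theorem sum_dualCoeff_add_minorant_nonneg {t : ℝ} (ht : 0 ≤ t) (ht' : t ≤ 1) :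
    0 ≤ ∑ k, dualCoeff k * t ^ (k : ℕ) +
      (∑ k, minorantCoeff k * t ^ (k : ℕ)) * (1 + t / 2 + t ^ 2 / 8 + t ^ 3 / 48) := by
  have hp : ∀ n : ℕ, 0 ≤ t ^ n ∧ t ^ (n + 5) ≤ t ^ 5 := fun n =>
    ⟨by positivity, pow_le_pow_of_le_one ht ht' (by omega)⟩
  have hc : 0 ≤ t * (t - 597 / 1000) ^ 2 := by positivity
  have p2 := (hp 2).1
  have p4 := (hp 4).1
  have p5 := (hp 5).1
  have p6 := (hp 6).1
  have q6 := (hp 1).2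
  have p7 := (hp 7).1
  have q7 := (hp 2).2
  have p8 := (hp 8).1
  have q8 := (hp 3).2
  have p9 := (hp 9).1
  have q9 := (hp 4).2
  have p10 := (hp 10).1
  have q10 := (hp 5).2
  have p11 := (hp 11).1
  have q11 := (hp 6).2
  have p12 := (hp 12).1
  have q12 := (hp 7).2
  have p13 := (hp 13).1
  have q13 := (hp 8).2
  rw [sum_dualCoeff_eq, sum_minorantCoeff]
  ring_nf at *
  linarith

theorem exp_eighth_le : Real.exp (1 / 8) ≤ 1.13315 := by
  refine (Real.exp_bound' (by norm_num) (by norm_num) (n := 5) (by norm_num)).trans ?_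
  norm_num [Finset.sum_range_succ, Nat.factorial]

theorem le_exp_neg_fifteen_eighths : (0.15335 : ℝ) ≤ Real.exp (-(15 / 4) / 2) := by
  have h : Real.exp (-(15 / 4) / 2) = (Real.exp (1 / 8) ^ 15)⁻¹ := by
    rw [← Real.exp_nat_mul, ← Real.exp_neg]
    norm_num
  rw [h, le_inv_comm₀ (by norm_num) (by positivity)]
  refine (pow_le_pow_left₀ (Real.exp_pos _).le exp_eighth_le 15).trans ?_
  norm_num

theorem tanhDefectMoment_one_le : tanhDefectMoment 1 ≤ 0.04176 := by
  have h := pow_le_pow_left₀ (by norm_num) Real.pi_gt_d6.le 2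
  rw [tanhDefectMoment, div_mul_eq_mul_div, div_le_iff₀ (by positivity)]
  norm_num at h ⊢
  linarith

theorem le_tanhDefectMoment_three : 0.00729 ≤ tanhDefectMoment 3 := by
  have h := pow_le_pow_left₀ Real.pi_pos.le Real.pi_lt_d6.le 4
  rw [tanhDefectMoment, div_mul_eq_mul_div, le_div_iff₀ (by positivity)]
  norm_num [Nat.factorial] at h ⊢
  linarith

theorem tanhDefectMoment_five_le : tanhDefectMoment 5 ≤ 0.003846 := by
  have h := pow_le_pow_left₀ (by norm_num) Real.pi_gt_d6.le 6
  rw [tanhDefectMoment, div_mul_eq_mul_div, div_le_iff₀ (by positivity)]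
  norm_num [Nat.factorial] at h ⊢
  linarith

theorem stmt_8 :
    ∃ (u : Polynomial ℝ) (c : ℝ), 0 < c ∧
      (let f : ℝ → ℝ := gaussPoly u
      let fhat : ℝ → ℝ := evenFT f
      (∀ x : ℝ, f x ≤ 0) ∧
      (∀ lam : ℝ, lam ∈ Set.Icc (3.5 : ℝ) 4 → fhat (Real.sqrt (lam - 1 / 4)) ≥ c) ∧
      (∀ lam : ℝ, (4 : ℝ) ≤ lam → fhat (Real.sqrt (lam - 1 / 4)) ≥ 0) ∧
      (1 / c) *
          (2 * (∫ ξ in Set.Ioi (0 : ℝ), ξ * fhat ξ * Real.tanh (π * ξ))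
            - (1 / Real.sqrt (2 * π)) * ∫ x : ℝ, f x * Real.cosh (x / 2)) < 7) := by
  have hF : ∀ ξ, evenFT (gaussPoly (∑ k, Polynomial.C (extremalCoeff k) *
      Polynomial.X ^ (k : ℕ))) ξ =
      (∑ k, dualCoeff k * (ξ ^ 2) ^ (k : ℕ)) * Real.exp (-ξ ^ 2 / 2) := fun ξ => by
    rw [evenFT_gaussPoly_s8, sum_extremalCoeff_mul_evenMomentPoly]
  have hC : 0 < ∑ k, dualCoeff k * (15 / 4 : ℝ) ^ (k : ℕ) := by
    rw [sum_dualCoeff_eq]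
    norm_num
  refine ⟨∑ k, Polynomial.C (extremalCoeff k) * Polynomial.X ^ (k : ℕ),
    (∑ k, dualCoeff k * (15 / 4 : ℝ) ^ (k : ℕ)) * Real.exp (-(15 / 4) / 2),
    mul_pos hC (Real.exp_pos _), fun x => ?_, fun lam hlam => ?_, fun lam hlam => ?_, ?_⟩
  · simp only [gaussPoly, Polynomial.eval_finsetSum, Polynomial.eval_mul, Polynomial.eval_C,
      Polynomial.eval_pow, Polynomial.eval_X]
    exact mul_nonpos_of_nonpos_of_nonneg (sum_extremalCoeff_nonpos (sq_nonneg x))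
      (Real.exp_pos _).le
  · obtain ⟨h1, h2⟩ := hlam
    norm_num at h1
    obtain ⟨s, rfl⟩ : ∃ s : ℝ, lam = 15 / 4 - 2 * s + 1 / 4 := ⟨(4 - lam) / 2, by ring⟩
    have hs : 0 ≤ s := by linarith
    have hs' : s ≤ 1 / 4 := by linarith
    rw [hF, Real.sq_sqrt (by linarith), add_sub_cancel_right, ge_iff_le,
      show -(15 / 4 - 2 * s) / 2 = -(15 / 4) / 2 + s by ring, Real.exp_add,
      mul_comm (Real.exp _) (Real.exp s), ← mul_assoc]
    refine mul_le_mul_of_nonneg_right ?_ (Real.exp_pos _).le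
    have hexp := Real.quadratic_le_exp_of_nonneg hs
    have hq : 0 ≤ 1 - s + s ^ 2 / 2 := by nlinarith
    have hone : 1 ≤ (1 - s + s ^ 2 / 2) * Real.exp s := by
      nlinarith [mul_le_mul_of_nonneg_left hexp hq, sq_nonneg (s ^ 2)]
    calc _ ≤ (∑ k, dualCoeff k * (15 / 4 : ℝ) ^ (k : ℕ)) * ((1 - s + s ^ 2 / 2) * Real.exp s) :=
          le_mul_of_one_le_right hC.le hone
      _ ≤ _ := by
          rw [← mul_assoc]
          exact mul_le_mul_of_nonneg_right (sum_dualCoeff_ge hs hs') (Real.exp_pos _).le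
  · rw [hF, Real.sq_sqrt (by linarith)]
    exact mul_nonneg (sum_dualCoeff_nonneg (by linarith)) (Real.exp_pos _).le
  · have hS : ∀ t : ℝ, 0 ≤ ∑ k, minorantCoeff k * t ^ (k : ℕ) := fun t => by
      rw [sum_minorantCoeff]
      positivity
    have hI := integral_mul_tanh_le dualCoeff minorantCoeff hF (fun t _ => hS t) fun x hx => by
      rw [hF]
      have hx2 : 0 ≤ x ^ 2 := sq_nonneg x
      rcases le_total (x ^ 2) 1 with h | h
      · have h1 := sum_dualCoeff_add_minorant_nonneg hx2 h
        have h2 := Real.sum_le_exp_of_nonneg (x := x ^ 2 / 2) (by positivity) 4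
        simp only [Finset.sum_range_succ, Finset.sum_range_zero, Nat.factorial] at h2
        have h3 : 1 + x ^ 2 / 2 + (x ^ 2) ^ 2 / 8 + (x ^ 2) ^ 3 / 48 ≤ Real.exp (x ^ 2 / 2) := by
          norm_num at h2
          linarith
        have h4 := mul_le_mul_of_nonneg_left h3 (hS (x ^ 2))
        have h5 : Real.exp (x ^ 2 / 2) * Real.exp (-x ^ 2 / 2) = 1 := by
          rw [← Real.exp_add, neg_div, add_neg_cancel, Real.exp_zero]
        calc 0 ≤ (∑ k, dualCoeff k * (x ^ 2) ^ (k : ℕ) +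
              (∑ k, minorantCoeff k * (x ^ 2) ^ (k : ℕ)) * Real.exp (x ^ 2 / 2)) *
              Real.exp (-x ^ 2 / 2) := mul_nonneg (by linarith) (Real.exp_pos _).le
          _ = _ := by rw [add_mul, mul_assoc _ (Real.exp _), h5, mul_one]
      · exact add_nonneg (mul_nonneg (sum_dualCoeff_nonneg h) (Real.exp_pos _).le) (hS _)
    rw [integral_gaussPoly_mul_cosh_half, sum_extremalCoeff_mul_evenMomentPoly, one_div,
      inv_mul_lt_iff₀ (mul_pos hC (Real.exp_pos _))]
    have e1 := exp_eighth_le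
    have e2 := le_exp_neg_fifteen_eighths
    have m1 := tanhDefectMoment_one_le
    have m3 := le_tanhDefectMoment_three
    have m5 := tanhDefectMoment_five_le
    simp only [Fin.sum_univ_succ, Fin.sum_univ_zero, dualCoeff, minorantCoeff, Fin.val_zero,
      Fin.val_succ, Matrix.cons_val_zero, Matrix.cons_val_succ, Nat.factorial] at hI ⊢
    norm_num at hI e1 e2 m1 m3 m5 ⊢
    linarith
end
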